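/- arXiv:2002.01364 — 10 statements merged into one kernel-verified Lean document; each statement's English description precedes it below -/
import Mathlib

section
/- Let u_1,…,u_p ∈ ℝ^d (with p ≥ 1) and u_1',…,u_q' ∈ ℝ^d, and let P := conv({u_1,…,u_p}) + cone({u_1',…,u_q'}) be the Minkowski sum of the convex hull of the points u_i and the convex cone of all nonnegative linear combinations of the points u_j'. Then the polar dual of P is P* = ⋂_{i=1}^p H_{u_i,≥−1} ∩ ⋂_{j=1}^q H_{u_j',≥0}. -/
open Set Pointwise

/-- The standard pairing `⟨v,u⟩ = ∑ i, v i * u i` on `ι → ℝ`. -/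
noncomputable def dotProd {ι : Type*} [Fintype ι] (v u : ι → ℝ) : ℝ := ∑ i, v i * u i

/-- The hyperplane `H_{v,h} = {u : ⟨v,u⟩ = h}`. -/
def hyperplane {ι : Type*} [Fintype ι] (v : ι → ℝ) (h : ℝ) : Set (ι → ℝ) :=
  {u | dotProd v u = h}

/-- The halfspace `H_{v,≥k} = {u : ⟨v,u⟩ ≥ k}`. -/
def halfspaceGe {ι : Type*} [Fintype ι] (v : ι → ℝ) (k : ℝ) : Set (ι → ℝ) :=
  {u | k ≤ dotProd v u}

/-- The polar dual `P* = {v : ⟨v,u⟩ ≥ -1 for all u ∈ P}`. -/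
def polarDual {ι : Type*} [Fintype ι] (P : Set (ι → ℝ)) : Set (ι → ℝ) :=
  {v | ∀ u ∈ P, -1 ≤ dotProd v u}

/-- Cast an integer vector to a real vector. -/
def castZ {ι : Type*} (w : ι → ℤ) : ι → ℝ := fun i => (w i : ℝ)

/-- A nonzero integer vector is primitive if the gcd of its coordinates is 1. -/
def IsPrimitiveVec {ι : Type*} [Fintype ι] (w : ι → ℤ) : Prop :=
  Finset.gcd Finset.univ w = 1

/-- The set of lattice points of `ι → ℝ`. -/
def latticePts (ι : Type*) : Set (ι → ℝ) := Set.range castZ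

/-- A lattice polytope: convex hull of a finite nonempty set of lattice points. -/
def IsLatticePolytope {ι : Type*} [Fintype ι] (P : Set (ι → ℝ)) : Prop :=
  ∃ S : Finset (ι → ℤ), S.Nonempty ∧ P = convexHull ℝ (castZ '' (S : Set (ι → ℤ)))

/-- A rational polytope: some positive integer dilate is a lattice polytope. -/
def IsRationalPolytope {ι : Type*} [Fintype ι] (P : Set (ι → ℝ)) : Prop :=
  ∃ n : ℕ, 0 < n ∧ IsLatticePolytope ((n : ℝ) • P)

/-- The cone of all nonnegative linear combinations of a finite family of vectors. -/
def coneOf {ι : Type*} [Fintype ι] {κ : Type*} [Fintype κ] (v : κ → ι → ℝ) :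
    Set (ι → ℝ) :=
  {x | ∃ c : κ → ℝ, (∀ i, 0 ≤ c i) ∧ x = ∑ i, c i • v i}

/-- The cone of all nonnegative linear combinations of elements of a set. -/
def coneHull {ι : Type*} [Fintype ι] (S : Set (ι → ℝ)) : Set (ι → ℝ) :=
  {x | ∃ (n : ℕ) (c : Fin n → ℝ) (u : Fin n → ι → ℝ),
    (∀ i, 0 ≤ c i) ∧ (∀ i, u i ∈ S) ∧ x = ∑ i, c i • u i}

/-- `v` is a minimal generating set for the cone it generates. -/
def IsMinimalGen {ι : Type*} [Fintype ι] {κ : Type*} [Fintype κ] [DecidableEq κ]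
    (v : κ → ι → ℝ) : Prop :=
  ∀ i : κ, v i ∉ coneOf (fun j : {j : κ // j ≠ i} => v j.1)

/-- The mutation condition for `(P,w,F)` with the family `{G_h}_{h ≤ 0}`:
`V(P) ∩ H_{w,h} ⊆ G_h + (−h)F ⊆ P ∩ H_{w,h}` for all `h ≤ 0`. -/
def MutCond {ι : Type*} [Fintype ι] (P : Set (ι → ℝ)) (w : ι → ℝ) (F : Set (ι → ℝ))
    (G : ℝ → Set (ι → ℝ)) : Prop :=
  ∀ h : ℝ, h ≤ 0 →
    (P.extremePoints ℝ) ∩ hyperplane w h ⊆ G h + (-h) • F ∧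
    G h + (-h) • F ⊆ P ∩ hyperplane w h

/-- The combinatorial mutation `mut_w(P,F;{G_h})` of a rational polytope. -/
def mutPoly {ι : Type*} [Fintype ι] (w : ι → ℝ) (F : Set (ι → ℝ)) (P : Set (ι → ℝ))
    (G : ℝ → Set (ι → ℝ)) : Set (ι → ℝ) :=
  convexHull ℝ ((⋃ h ∈ Set.Iic (0 : ℝ), G h) ∪ ⋃ h ∈ Set.Ici (0 : ℝ), (P ∩ hyperplane w h + h • F))

/-- The combinatorial mutation `mut_w(C,F;{G_h})` of a cone. -/
def mutCone {ι : Type*} [Fintype ι] (w : ι → ℝ) (F : Set (ι → ℝ)) (C : Set (ι → ℝ))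
    (G : ℝ → Set (ι → ℝ)) : Set (ι → ℝ) :=
  coneHull ((⋃ h ∈ Set.Iic (0 : ℝ), G h) ∪ ⋃ h ∈ Set.Ici (0 : ℝ), (C ∩ hyperplane w h + h • F))

/-- `C` is a rational polyhedral pointed cone: generated by finitely many primitive lattice
points forming a minimal generating set, and containing no line. -/
def IsRatPointedCone {ι : Type*} [Fintype ι] (C : Set (ι → ℝ)) : Prop :=
  ∃ (m : ℕ) (v : Fin m → ι → ℤ),
    (∀ i, IsPrimitiveVec (v i)) ∧
    IsMinimalGen (fun i => castZ (v i)) ∧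
    C = coneOf (fun i => castZ (v i)) ∧
    C ∩ (-C) = {0}

/-- The piecewise-linear map `φ_{w,F}(u) = u − u_min · w`, `u_min = min{⟨u,v⟩ : v ∈ F}`. -/
noncomputable def phiMut {ι : Type*} [Fintype ι] (w : ι → ℝ) (F : Set (ι → ℝ))
    (u : ι → ℝ) : ι → ℝ :=
  u - sInf ((fun v => dotProd u v) '' F) • w

/-- The recession cone of a set. -/
def recessionCone {ι : Type*} [Fintype ι] (A : Set (ι → ℝ)) : Set (ι → ℝ) :=
  {y | ∀ x ∈ A, ∀ t : ℝ, 0 ≤ t → x + t • y ∈ A}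
lemma dotProd_comm' {ι : Type*} [Fintype ι] (v u : ι → ℝ) : dotProd v u = dotProd u v := by
  simp only [dotProd, mul_comm]

lemma dotProd_add' {ι : Type*} [Fintype ι] (v x y : ι → ℝ) :
    dotProd v (x + y) = dotProd v x + dotProd v y := by
  simp [dotProd, mul_add, Finset.sum_add_distrib]

lemma dotProd_smul' {ι : Type*} [Fintype ι] (v x : ι → ℝ) (c : ℝ) :
    dotProd v (c • x) = c * dotProd v x := by
  simp only [dotProd, Pi.smul_apply, smul_eq_mul, Finset.mul_sum]
  exact Finset.sum_congr rfl fun i _ => by ring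

lemma dotProd_sum' {ι κ : Type*} [Fintype ι] [Fintype κ] (v : ι → ℝ) (c : κ → ℝ)
    (x : κ → ι → ℝ) :
    dotProd v (∑ j, c j • x j) = ∑ j, c j * dotProd v (x j) := by
  simp only [dotProd, Finset.sum_apply, Pi.smul_apply, smul_eq_mul, Finset.mul_sum]
  rw [Finset.sum_comm]
  exact Finset.sum_congr rfl fun i _ => Finset.sum_congr rfl fun j _ => by ring

/-- The polar dual of `P = conv{u_1,…,u_p} + cone{u'_1,…,u'_q}` is
`⋂_i H_{u_i, ≥ -1} ∩ ⋂_j H_{u'_j, ≥ 0}`. -/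
theorem stmt_0 {d p q : ℕ} (hp : 1 ≤ p)
    (u : Fin p → Fin d → ℝ) (u' : Fin q → Fin d → ℝ) :
    polarDual (convexHull ℝ (Set.range u) + coneOf u') =
      (⋂ i, halfspaceGe (u i) (-1)) ∩ ⋂ j, halfspaceGe (u' j) 0 := by
  ext v
  simp only [polarDual, halfspaceGe, Set.mem_inter_iff, Set.mem_iInter, Set.mem_setOf_eq]
  constructor
  · intro h
    have key : ∀ i (j : Fin q) (t : ℝ), 0 ≤ t →
        -1 ≤ dotProd v (u i) + t * dotProd v (u' j) := by
      intro i j t ht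
      have := h (u i + t • u' j) (Set.add_mem_add
        (subset_convexHull ℝ _ (Set.mem_range_self i))
        ⟨Pi.single j t, fun k => by
          by_cases hk : k = j
          · subst hk; simpa using ht
          · simp [hk], by
          rw [Finset.sum_eq_single j]
          · simp
          · intro k _ hk; simp [hk]
          · simp⟩)
      rwa [dotProd_add', dotProd_smul'] at this
    refine ⟨fun i => ?_, fun j => ?_⟩
    · have := h (u i + 0) (Set.add_mem_add
        (subset_convexHull ℝ _ (Set.mem_range_self i)) ⟨0, by simp, by simp⟩)
      rwa [add_zero, dotProd_comm'] at this
    · rw [dotProd_comm']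
      by_contra! hb
      set b := dotProd v (u' j)
      set a := dotProd v (u ⟨0, hp⟩)
      have h1 := key ⟨0, hp⟩ j ((|a| + 2) / (-b)) (div_nonneg (by positivity) (by linarith))
      have h2 : (|a| + 2) / (-b) * b = -(|a| + 2) := by
        have : b ≠ 0 := hb.ne
        field_simp
      have h3 : -1 ≤ a + (|a| + 2) / (-b) * b := h1
      rw [h2] at h3
      linarith [le_abs_self a]
  · rintro ⟨h1, h2⟩ w hw
    obtain ⟨x, hx, y, ⟨c, hc, rfl⟩, rfl⟩ := Set.mem_add.1 hw
    rw [dotProd_add', dotProd_sum']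
    have hy : 0 ≤ ∑ j, c j * dotProd v (u' j) :=
      Finset.sum_nonneg fun j _ => mul_nonneg (hc j) (by rw [dotProd_comm']; exact h2 j)
    have hconv : Convex ℝ {x | -1 ≤ dotProd v x} := by
      intro x hx y hy a b ha hb hab
      simp only [Set.mem_setOf_eq] at *
      rw [dotProd_add', dotProd_smul', dotProd_smul']
      nlinarith
    have hx' : -1 ≤ dotProd v x := convexHull_min (by
      rintro _ ⟨i, rfl⟩
      change -1 ≤ dotProd v (u i)
      rw [dotProd_comm']; exact h1 i) hconv hx
    linarith
end

section
/- Let P ⊆ ℝ^d be a rational polytope, w ∈ ℤ^d primitive, F ⊆ w^⊥ a lattice polytope, and suppose the family {G_h}_{h≤0} satisfies the mutation condition for (P,w,F). Let Q := mut_w(P,F;{G_h}). Then the family {P_{−w,h}}_{h≤0} (where P_{−w,h} := P ∩ H_{−w,h}) satisfies the mutation condition for (Q,−w,F), and mut_{−w}(Q,F;{P_{−w,h}}) = P. -/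
open Set Pointwise

theorem dot_add' {d : ℕ} (w x y : Fin d → ℝ) : dotProd w (x + y) = dotProd w x + dotProd w y := by
  simp [dotProd, mul_add, Finset.sum_add_distrib]

theorem dot_smul' {d : ℕ} (w x : Fin d → ℝ) (a : ℝ) : dotProd w (a • x) = a * dotProd w x := by
  simp only [dotProd, Finset.mul_sum, Pi.smul_apply, smul_eq_mul]
  exact Finset.sum_congr rfl fun i _ => by ring

theorem dot_neg' {d : ℕ} (w x : Fin d → ℝ) : dotProd (-w) x = - dotProd w x := by
  simp [dotProd]

theorem ratPoly_hull {d : ℕ} (P : Set (Fin d → ℝ)) (hP : IsRationalPolytope P) :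
    Convex ℝ P ∧ convexHull ℝ (P.extremePoints ℝ) = P := by
  obtain ⟨n, hn, S, -, hS⟩ := hP
  have hn' : (n : ℝ) ≠ 0 := by positivity
  set A : Set (Fin d → ℝ) := (n : ℝ)⁻¹ • (castZ '' (S : Set (Fin d → ℤ))) with hA
  have hAf : A.Finite := (S.finite_toSet.image _).image _
  have hPA : P = convexHull ℝ A := by
    rw [hA, convexHull_smul, ← hS, smul_smul, inv_mul_cancel₀ hn', one_smul]
  have hc : Convex ℝ P := hPA ▸ convex_convexHull ℝ A
  refine ⟨hc, ?_⟩
  have hK : IsCompact P := by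
    rw [hPA]; exact hAf.isCompact_convexHull (𝕜 := ℝ)
  have hE : (P.extremePoints ℝ).Finite := by
    apply hAf.subset
    rw [hPA]; exact extremePoints_convexHull_subset
  have h1 := closure_convexHull_extremePoints hK hc
  rwa [(hE.isCompact_convexHull (𝕜 := ℝ)).isClosed.closure_eq] at h1

/-- Auxiliary convex set containing the mutation. -/
def auxT {d : ℕ} (w : Fin d → ℝ) (F P : Set (Fin d → ℝ)) : Set (Fin d → ℝ) :=
  {x | ∃ (y z : Fin d → ℝ) (t s : ℝ), 0 ≤ t ∧ 0 ≤ s ∧ z ∈ t • F ∧ x = y + z ∧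
    dotProd w x = t - s ∧ ∀ u ∈ s • F, y + u ∈ P}

theorem auxT_convex {d : ℕ} (w : Fin d → ℝ) (F P : Set (Fin d → ℝ)) (hF : Convex ℝ F)
    (hP : Convex ℝ P) : Convex ℝ (auxT w F P) := by
  rintro x₁ ⟨y₁, z₁, t₁, s₁, ht₁, hs₁, hz₁, hx₁, hd₁, hu₁⟩ x₂
    ⟨y₂, z₂, t₂, s₂, ht₂, hs₂, hz₂, hx₂, hd₂, hu₂⟩ a b ha hb hab
  refine ⟨a • y₁ + b • y₂, a • z₁ + b • z₂, a * t₁ + b * t₂, a * s₁ + b * s₂, by positivity,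
    by positivity, ?_, ?_, ?_, ?_⟩
  · rw [hF.add_smul (by positivity) (by positivity), mul_smul, mul_smul]
    exact Set.add_mem_add (Set.smul_mem_smul_set hz₁) (Set.smul_mem_smul_set hz₂)
  · rw [hx₁, hx₂]; module
  · rw [dot_add', dot_smul', dot_smul', hd₁, hd₂]; ring
  · intro u hu
    rw [hF.add_smul (by positivity) (by positivity), mul_smul, mul_smul] at hu
    obtain ⟨_, ⟨u₁, h₁, rfl⟩, _, ⟨u₂, h₂, rfl⟩, rfl⟩ := hu
    have := hP (hu₁ u₁ h₁) (hu₂ u₂ h₂) ha hb hab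
    convert this using 1
    module

/-- If `{G_h}` satisfies the mutation condition for `(P,w,F)` and
`Q = mut_w(P,F;{G_h})`, then `{P_{-w,h}}` satisfies the mutation condition for
`(Q,-w,F)` and `mut_{-w}(Q,F;{P_{-w,h}}) = P`. -/
theorem stmt_3 {d : ℕ} (P : Set (Fin d → ℝ)) (hP : IsRationalPolytope P)
    (w : Fin d → ℤ) (hw : IsPrimitiveVec w)
    (F : Set (Fin d → ℝ)) (hF : IsLatticePolytope F) (hFw : F ⊆ hyperplane (castZ w) 0)
    (G : ℝ → Set (Fin d → ℝ))
    (hGrat : ∀ h : ℝ, h ≤ 0 → G h = ∅ ∨ IsRationalPolytope (G h))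
    (hG : MutCond P (castZ w) F G) :
    MutCond (mutPoly (castZ w) F P G) (-(castZ w)) F
        (fun h => P ∩ hyperplane (-(castZ w)) h) ∧
      mutPoly (-(castZ w)) F (mutPoly (castZ w) F P G)
        (fun h => P ∩ hyperplane (-(castZ w)) h) = P := by
  have hFc : Convex ℝ F := by
    obtain ⟨S, -, rfl⟩ := hF
    exact convex_convexHull ℝ _
  have hFne : F.Nonempty := by
    obtain ⟨S, hS, rfl⟩ := hF
    exact (hS.to_set.image _).convexHull
  obtain ⟨hPc, hPe⟩ := ratPoly_hull P hP
  generalize castZ w = v at *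
  have hF0 : ∀ f ∈ F, dotProd v f = 0 := fun f hf => hFw hf
  have hGh : ∀ h ≤ 0, ∀ g ∈ G h, dotProd v g = h := by
    intro h hh g hg
    obtain ⟨f, hf⟩ := hFne
    have := ((hG h hh).2 (Set.add_mem_add hg (Set.smul_mem_smul_set hf))).2
    change dotProd v (g + (-h) • f) = h at this
    rwa [dot_add', dot_smul', hF0 f hf, mul_zero, add_zero] at this
  have hGQ : ∀ h ≤ 0, ∀ g ∈ G h, g ∈ mutPoly v F P G := by
    intro h hh g hg
    apply subset_convexHull
    left
    simp only [Set.mem_iUnion]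
    exact ⟨h, hh, hg⟩
  have hPQ : ∀ h ≥ 0, ∀ p ∈ P ∩ hyperplane v h + h • F, p ∈ mutPoly v F P G := by
    intro h hh g hg
    apply subset_convexHull
    right
    simp only [Set.mem_iUnion]
    exact ⟨h, hh, hg⟩
  have hneg : ∀ h, hyperplane (-v) h = hyperplane v (-h) := by
    intro h
    ext x
    simp only [hyperplane, Set.mem_ofPred_eq, dot_neg']
    constructor <;> intro <;> linarith
  have hdot : ∀ h, ∀ p ∈ P ∩ hyperplane v h + h • F, dotProd v p = h := by
    rintro h _ ⟨p, ⟨-, hp⟩, _, ⟨f, hf, rfl⟩, rfl⟩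
    simp only [dot_add', dot_smul', hF0 f hf]
    simpa [hyperplane] using hp
  constructor
  · intro h hh
    simp only [hneg]
    refine ⟨?_, fun x hx => ⟨hPQ (-h) (by linarith) x hx, hdot _ x hx⟩⟩
    rintro x ⟨hx, hxh⟩
    have hxS := extremePoints_convexHull_subset hx
    change dotProd v x = -h at hxh
    rcases hxS with hxS | hxS
    · simp only [Set.mem_iUnion] at hxS
      obtain ⟨k, hk, hxk⟩ := hxS
      have hk : k ≤ 0 := hk
      have e := hGh k hk x hxk
      have hk0 : k = 0 := by linarith
      have hh0 : h = 0 := by linarith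
      subst hk0 hh0
      have := (hG 0 le_rfl).2
      simp only [neg_zero, Set.zero_smul_set hFne, add_zero] at this ⊢
      exact this hxk
    · simp only [Set.mem_iUnion] at hxS
      obtain ⟨k, hk, hxk⟩ := hxS
      have e := hdot k x hxk
      have : k = -h := by linarith
      rwa [this] at hxk
  · apply Set.Subset.antisymm
    · apply convexHull_min _ hPc
      apply Set.union_subset
      · simp only [Set.iUnion_subset_iff]
        exact fun h _ x hx => hx.1
      · simp only [Set.iUnion_subset_iff]
        intro h hh
        have hh : 0 ≤ h := hh
        rintro _ ⟨q, ⟨hq, hqh⟩, u, hu, rfl⟩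
        have hqT : q ∈ auxT v F P := by
          refine convexHull_min ?_ (auxT_convex v F P hFc hPc) hq
          apply Set.union_subset
          · simp only [Set.iUnion_subset_iff]
            intro k hk g hg
            have hk : k ≤ 0 := hk
            refine ⟨g, 0, 0, -k, le_rfl, by linarith, ?_, by simp, ?_, ?_⟩
            · rw [Set.zero_smul_set hFne]; rfl
            · rw [hGh k hk g hg]; ring
            · intro z hz
              exact ((hG k hk).2 (Set.add_mem_add hg hz)).1
          · simp only [Set.iUnion_subset_iff]
            intro k hk x hx
            have e := hdot k x hx
            obtain ⟨p, hp, z, hz, rfl⟩ := hx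
            refine ⟨p, z, k, 0, hk, le_rfl, hz, rfl, by rw [sub_zero]; exact e, ?_⟩
            intro z hz
            rw [Set.zero_smul_set hFne] at hz
            rw [Set.mem_zero.1 hz, add_zero]
            exact hp.1
        obtain ⟨y, z, t, s, ht, hs, hz, rfl, hd, hP'⟩ := hqT
        rw [hneg] at hqh
        change dotProd v (y + z) = -h at hqh
        have hsum : s = t + h := by linarith
        show y + z + u ∈ P
        rw [add_assoc]
        apply hP'
        rw [hsum, hFc.add_smul ht hh]
        exact Set.add_mem_add hz hu
    · conv_lhs => rw [← hPe]
      apply convexHull_mono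
      intro x hx
      rcases le_total 0 (dotProd v x) with h0 | h0
      · left
        simp only [Set.mem_iUnion]
        refine ⟨-dotProd v x, by simpa using h0, hx.1, ?_⟩
        rw [hneg, neg_neg]; rfl
      · right
        simp only [Set.mem_iUnion]
        refine ⟨-dotProd v x, by simpa using h0, ?_⟩
        obtain ⟨g, hg, z, hz, e⟩ := (hG _ h0).1 ⟨hx, rfl⟩
        refine ⟨g, ⟨hGQ _ h0 g hg, ?_⟩, z, hz, e⟩
        rw [hneg, neg_neg]
        exact hGh _ h0 g hg
end

section
/- Let P ⊆ ℝ^d be a rational polytope, w ∈ ℤ^d primitive, F ⊆ w^⊥ a lattice polytope, and suppose {G_h}_{h≤0} satisfies the mutation condition for (P,w,F). Let Q := mut_w(P,F;{G_h}). Then: (i) every vertex v of Q can be written as v = v_P + ⟨w,v⟩·v_F for some v_P ∈ P and some vertex v_F of F; and (ii) every vertex v of P can be written as v = v_Q − ⟨w,v⟩·v_F for some v_Q ∈ Q and some vertex v_F of F. -/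
open Set Pointwise

lemma dotProd_add_smul_of_mem {d : ℕ} {w : Fin d → ℝ} (u f : Fin d → ℝ) (c : ℝ)
    (hf : f ∈ hyperplane w 0) : dotProd w (u + c • f) = dotProd w u := by
  have hf' : ∑ i, w i * f i = 0 := hf
  have : ∑ i, w i * (c * f i) = c * ∑ i, w i * f i := by
    rw [Finset.mul_sum]
    exact Finset.sum_congr rfl fun i _ => by ring
  simp [dotProd, mul_add, Finset.sum_add_distrib, this, hf']

lemma IsLatticePolytope.exists_extreme {d : ℕ} {F : Set (Fin d → ℝ)} (hF : IsLatticePolytope F) :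
    (F.extremePoints ℝ).Nonempty := by
  obtain ⟨S, hS, rfl⟩ := hF
  apply IsCompact.extremePoints_nonempty
  · exact (S.finite_toSet.image _).isCompact_convexHull ℝ
  · exact (hS.to_set.image _).convexHull

/-- If `p + c f` is extreme in `A ⊇ p + c F`, with `c ≠ 0`, then `f` is extreme in `F`. -/
lemma extreme_of_add_smul {d : ℕ} {A F : Set (Fin d → ℝ)} {p f : Fin d → ℝ} {c : ℝ} (hc : c ≠ 0)
    (hf : f ∈ F) (hA : ∀ g ∈ F, p + c • g ∈ A) (hv : p + c • f ∈ A.extremePoints ℝ) :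
    f ∈ F.extremePoints ℝ := by
  rw [mem_extremePoints_iff_left] at hv ⊢
  refine ⟨hf, fun x hx y hy hxy => ?_⟩
  obtain ⟨a, b, ha, hb, hab, rfl⟩ := hxy
  have := hv.2 _ (hA x hx) _ (hA y hy) ⟨a, b, ha, hb, hab, by
    have : p = (a + b) • p := by rw [hab, one_smul]
    conv_rhs => rw [this]
    module⟩
  exact smul_right_injective _ hc (add_left_cancel this)

/-- With `Q = mut_w(P,F;{G_h})`, every vertex `v` of `Q` can be written
`v = v_P + ⟨w,v⟩ v_F` with `v_P ∈ P`, `v_F ∈ V(F)`, and every vertex `v` of `P` can be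
written `v = v_Q − ⟨w,v⟩ v_F` with `v_Q ∈ Q`, `v_F ∈ V(F)`. -/
theorem stmt_4 {d : ℕ} (P : Set (Fin d → ℝ)) (hP : IsRationalPolytope P)
    (w : Fin d → ℤ) (hw : IsPrimitiveVec w)
    (F : Set (Fin d → ℝ)) (hF : IsLatticePolytope F) (hFw : F ⊆ hyperplane (castZ w) 0)
    (G : ℝ → Set (Fin d → ℝ))
    (hGrat : ∀ h : ℝ, h ≤ 0 → G h = ∅ ∨ IsRationalPolytope (G h))
    (hG : MutCond P (castZ w) F G)
    (Q : Set (Fin d → ℝ)) (hQ : Q = mutPoly (castZ w) F P G) :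
    (∀ v ∈ Q.extremePoints ℝ, ∃ vP ∈ P, ∃ vF ∈ F.extremePoints ℝ,
        v = vP + dotProd (castZ w) v • vF) ∧
    (∀ v ∈ P.extremePoints ℝ, ∃ vQ ∈ Q, ∃ vF ∈ F.extremePoints ℝ,
        v = vQ - dotProd (castZ w) v • vF) := by
  obtain ⟨f₀, hf₀⟩ := hF.exists_extreme
  have hpos : ∀ h : ℝ, 0 ≤ h → ∀ p ∈ P, dotProd (castZ w) p = h → ∀ f ∈ F, p + h • f ∈ Q := by
    intro h hh p hp hph f hf
    rw [hQ]
    apply subset_convexHull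
    right
    simp only [mem_iUnion]
    exact ⟨h, hh, Set.add_mem_add ⟨hp, hph⟩ (Set.smul_mem_smul_set hf)⟩
  have hneg : ∀ h : ℝ, h ≤ 0 → ∀ g ∈ G h, g ∈ Q := by
    intro h hh g hg
    rw [hQ]
    apply subset_convexHull
    left
    simp only [mem_iUnion]
    exact ⟨h, hh, hg⟩
  have hGP : ∀ h : ℝ, h ≤ 0 → ∀ g ∈ G h, ∀ f ∈ F,
      g + (-h) • f ∈ P ∧ dotProd (castZ w) (g + (-h) • f) = h := fun h hh g hg f hf =>
    (hG h hh).2 (Set.add_mem_add hg (Set.smul_mem_smul_set hf))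
  constructor
  · intro v hv
    have hvS := extremePoints_convexHull_subset (by rw [hQ] at hv; exact hv)
    rcases hvS with hvS | hvS
    · simp only [mem_iUnion] at hvS
      obtain ⟨h, hh, hg⟩ := hvS
      obtain ⟨h1, h2⟩ := hGP h hh v hg f₀ hf₀.1
      rw [dotProd_add_smul_of_mem _ _ _ (hFw hf₀.1)] at h2
      refine ⟨_, h1, f₀, hf₀, ?_⟩
      rw [h2]
      module
    · simp only [mem_iUnion] at hvS
      obtain ⟨h, hh, hvS⟩ := hvS
      obtain ⟨p, ⟨hp, hph⟩, _, ⟨f, hf, rfl⟩, rfl⟩ := hvS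
      have hd : dotProd (castZ w) (p + h • f) = h := by
        rw [dotProd_add_smul_of_mem _ _ _ (hFw hf)]; exact hph
      simp only [hd]
      by_cases h0 : h = 0
      · subst h0
        exact ⟨p, hp, f₀, hf₀, by simp⟩
      · exact ⟨p, hp, f, extreme_of_add_smul h0 hf (fun g hg => hpos h hh p hp hph g hg) hv, rfl⟩
  · intro v hv
    rcases le_or_gt 0 (dotProd (castZ w) v) with h0 | h0
    · exact ⟨_, hpos _ h0 v hv.1 rfl f₀ hf₀.1, f₀, hf₀, by simp⟩
    · obtain ⟨g, hg, _, ⟨f, hf, rfl⟩, hgf⟩ := (hG _ h0.le).1 ⟨hv, rfl⟩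
      have hgf' : g + (-dotProd (castZ w) v) • f = v := hgf
      refine ⟨g, hneg _ h0.le g hg, f, ?_, ?_⟩
      · refine extreme_of_add_smul (neg_ne_zero.2 h0.ne) hf
          (fun k hk => (hGP _ h0.le g hg k hk).1) (A := P) (p := g) ?_
        rw [hgf']; exact hv
      · conv_lhs => rw [← hgf']
        module
end

section
/- Let P ⊆ ℝ^d be a rational polytope, w ∈ ℤ^d primitive, and F ⊆ w^⊥ a lattice polytope. If two families {G_h}_{h≤0} and {G_h'}_{h≤0} both satisfy the mutation condition for (P,w,F), then mut_w(P,F;{G_h}) = mut_w(P,F;{G_h'}). (Hence the combinatorial mutation mut_w(P,F) is independent of the choice of the family {G_h}.) -/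
open Set Pointwise

/-- A rational polytope is the convex hull of a finite set. -/
lemma IsRationalPolytope.exists_finite {d : ℕ} {P : Set (Fin d → ℝ)}
    (hP : IsRationalPolytope P) :
    ∃ T : Set (Fin d → ℝ), T.Finite ∧ P = convexHull ℝ T := by
  obtain ⟨n, hn, S, -, hS⟩ := hP
  have hn' : (n : ℝ) ≠ 0 := by positivity
  refine ⟨(n : ℝ)⁻¹ • (castZ '' (S : Set (Fin d → ℤ))),
    ((S.finite_toSet.image _).smul_set), ?_⟩
  rw [convexHull_smul, ← hS, smul_smul, inv_mul_cancel₀ hn', one_smul]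

/-- The pairing with `w` as a linear map. -/
noncomputable def dotLin {d : ℕ} (w : Fin d → ℝ) : (Fin d → ℝ) →ₗ[ℝ] ℝ where
  toFun u := dotProd w u
  map_add' x y := by simp [dotProd, mul_add, Finset.sum_add_distrib]
  map_smul' c x := by
    simp only [dotProd, Pi.smul_apply, smul_eq_mul, RingHom.id_apply, Finset.mul_sum]
    exact Finset.sum_congr rfl fun i _ => by ring

lemma mut_aux {d : ℕ} (P : Set (Fin d → ℝ)) (hP : IsRationalPolytope P)
    (w : Fin d → ℝ)
    (F : Set (Fin d → ℝ)) (hF : IsLatticePolytope F) (hFw : F ⊆ hyperplane w 0)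
    (G G' : ℝ → Set (Fin d → ℝ))
    (hG'rat : ∀ h : ℝ, h ≤ 0 → G' h = ∅ ∨ IsRationalPolytope (G' h))
    (hG : MutCond P w F G) (hG' : MutCond P w F G') :
    mutPoly w F P G ⊆ mutPoly w F P G' := by
  refine convexHull_min ?_ (convex_convexHull ℝ _)
  refine union_subset ?_ (subset_union_right.trans (subset_convexHull ℝ _))
  refine iUnion₂_subset fun h hh x hx => ?_
  have hh : h ≤ 0 := hh
  -- basic facts
  obtain ⟨T, hT, hPT⟩ := hP.exists_finite
  have hPc : IsCompact P := hPT ▸ hT.isCompact_convexHull ℝ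
  have hPconv : Convex ℝ P := hPT ▸ convex_convexHull ℝ T
  have hV : (P.extremePoints ℝ).Finite := by
    rw [hPT]; exact hT.subset extremePoints_convexHull_subset
  have hPV : P = convexHull ℝ (P.extremePoints ℝ) := by
    rw [← (hV.isCompact_convexHull ℝ).isClosed.closure_eq]
    exact (closure_convexHull_extremePoints hPc hPconv).symm
  obtain ⟨S, hSne, hFS⟩ := hF
  have hFc : IsCompact F := hFS ▸ (S.finite_toSet.image _).isCompact_convexHull ℝ
  have hFne : F.Nonempty := by
    rw [hFS, convexHull_nonempty_iff]
    exact hSne.to_set.image _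
  set W := dotLin w with hW
  have hWd : ∀ u, dotProd w u = W u := fun u => rfl
  -- compact subset
  let A : (Fin d → ℝ) → Set (Fin d → ℝ) := fun v =>
    if W v ≤ 0 then G' (W v) else {v} + (W v) • F
  have hAfin : ∀ v, ∃ B : Set (Fin d → ℝ), B.Finite ∧ A v = convexHull ℝ B := by
    intro v
    by_cases hv : W v ≤ 0
    · simp only [A, if_pos hv]
      rcases hG'rat _ hv with h0 | h0
      · exact ⟨∅, finite_empty, by rw [h0, convexHull_empty]⟩
      · exact h0.exists_finite
    · simp only [A, if_neg hv]
      refine ⟨{v} + W v • (castZ '' (S : Set (Fin d → ℤ))),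
        (finite_singleton v).add ((S.finite_toSet.image _).smul_set), ?_⟩
      rw [convexHull_add, convexHull_smul, convexHull_singleton, hFS]
  choose B hBfin hAB using hAfin
  have hKe : convexHull ℝ (⋃ v ∈ P.extremePoints ℝ, A v) =
      convexHull ℝ (⋃ v ∈ P.extremePoints ℝ, B v) := by
    refine Subset.antisymm (convexHull_min (iUnion₂_subset fun v hv => ?_)
      (convex_convexHull ℝ _)) (convexHull_mono (iUnion₂_mono fun v hv => ?_))
    · rw [hAB]
      exact convexHull_mono (subset_biUnion_of_mem (u := B) hv)
    · rw [hAB]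
      exact subset_convexHull ℝ _
  have hKc : IsCompact (convexHull ℝ (⋃ v ∈ P.extremePoints ℝ, A v)) := by
    rw [hKe]
    exact (hV.biUnion fun v _ => hBfin v).isCompact_convexHull ℝ
  have hsub : convexHull ℝ (⋃ v ∈ P.extremePoints ℝ, A v) ⊆ mutPoly w F P G' := by
    refine convexHull_mono (iUnion₂_subset fun v hvP => ?_)
    by_cases hv : W v ≤ 0
    · simp only [A, if_pos hv]
      exact (subset_biUnion_of_mem (u := G') (show W v ∈ Iic (0:ℝ) from hv)).trans
        subset_union_left
    · simp only [A, if_neg hv]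
      refine Subset.trans ?_ subset_union_right
      refine Subset.trans ?_ (subset_biUnion_of_mem
        (u := fun h => P ∩ hyperplane w h + h • F) (show W v ∈ Ici (0:ℝ) from (not_le.1 hv).le))
      exact add_subset_add_right (singleton_subset_iff.2 ⟨extremePoints_subset hvP, rfl⟩)
  apply hsub
  by_contra hxK
  obtain ⟨l, u, hlx, hlK⟩ := geometric_hahn_banach_point_closed
    (convex_convexHull ℝ (⋃ v ∈ P.extremePoints ℝ, A v)) hKc.isClosed hxK
  obtain ⟨f, hfF, hfmin⟩ := hFc.exists_isMinOn hFne l.continuous.continuousOn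
  have hfmin : ∀ g ∈ F, l f ≤ l g := fun g hg => hfmin hg
  have hp : x + (-h) • f ∈ P ∩ hyperplane w h :=
    (hG h hh).2 (add_mem_add hx (smul_mem_smul_set hfF))
  have hpw : W (x + (-h) • f) = h := hp.2
  let ψ : (Fin d → ℝ) →ₗ[ℝ] ℝ := (l : (Fin d → ℝ) →ₗ[ℝ] ℝ) + (l f) • W
  have hψ : ∀ y, ψ y = l y + l f * W y := fun y => rfl
  have key : ∀ v ∈ P.extremePoints ℝ, l x < ψ v := by
    intro v hv
    have hA : ∀ a ∈ A v, l x < l a := fun a ha =>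
      hlx.trans (hlK a (subset_convexHull ℝ _ (mem_biUnion hv ha)))
    rw [hψ]
    by_cases hvW : W v ≤ 0
    · obtain ⟨g, hg, z, ⟨f', hf', rfl⟩, hgz⟩ := (hG' (W v) hvW).1 ⟨hv, rfl⟩
      have h1 := hA g (by simp only [A, if_pos hvW]; exact hg)
      have h2 := hfmin f' hf'
      have h3 : l v = l g + (-(W v)) * l f' := by
        conv_lhs => rw [← hgz]
        simp
      rw [h3]
      nlinarith
    · have h1 := hA (v + W v • f) (by
        simp only [A, if_neg hvW]
        exact add_mem_add rfl (smul_mem_smul_set hfF))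
      simp only [map_add, map_smul, smul_eq_mul] at h1
      linarith
  have hlt : l x < ψ (x + (-h) • f) := by
    have : P ⊆ {y | l x < ψ y} := by
      rw [hPV]
      exact convexHull_min key (convex_halfSpace_gt ψ.isLinear _)
    exact this hp.1
  rw [hψ, hpw] at hlt
  simp only [map_add, map_smul, smul_eq_mul] at hlt
  linarith

/-- The combinatorial mutation does not depend on the choice of the
family `{G_h}`. -/
theorem stmt_5 {d : ℕ} (P : Set (Fin d → ℝ)) (hP : IsRationalPolytope P)
    (w : Fin d → ℤ) (hw : IsPrimitiveVec w)
    (F : Set (Fin d → ℝ)) (hF : IsLatticePolytope F) (hFw : F ⊆ hyperplane (castZ w) 0)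
    (G G' : ℝ → Set (Fin d → ℝ))
    (hGrat : ∀ h : ℝ, h ≤ 0 → G h = ∅ ∨ IsRationalPolytope (G h))
    (hG'rat : ∀ h : ℝ, h ≤ 0 → G' h = ∅ ∨ IsRationalPolytope (G' h))
    (hG : MutCond P (castZ w) F G) (hG' : MutCond P (castZ w) F G') :
    mutPoly (castZ w) F P G = mutPoly (castZ w) F P G' := by
  exact Subset.antisymm
    (mut_aux P hP _ F hF hFw G G' hG'rat hG hG')
    (mut_aux P hP _ F hF hFw G' G hGrat hG' hG)
end

section
/- Let w ∈ ℤ^d be primitive and F ⊆ w^⊥ a lattice polytope. Then: (i) for every u ∈ ℝ^d there exists a vertex v_F of F such that φ_{w,F}(u) = u − ⟨u,v_F⟩·w; (ii) for each vertex v_F of F, the linear map u ↦ u − ⟨u,v_F⟩·w is a linear automorphism of ℝ^d that maps ℤ^d bijectively onto ℤ^d; and (iii) φ_{w,F} maps ℤ^d bijectively onto ℤ^d. -/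
open Set Pointwise

theorem dotProd_sub_smul' {d : ℕ} (w u v : Fin d → ℝ) (c : ℝ) (h : dotProd w v = 0) :
    dotProd (u - c • w) v = dotProd u v := by
  have : dotProd (u - c • w) v = dotProd u v - c * dotProd w v := by
    simp only [dotProd, Finset.mul_sum, ← Finset.sum_sub_distrib]
    refine Finset.sum_congr rfl fun i _ => ?_
    simp only [Pi.sub_apply, Pi.smul_apply, smul_eq_mul]
    ring
  rw [this, h]; ring

theorem lattice_sub_smul {d : ℕ} (w : Fin d → ℤ) (u v : Fin d → ℝ) (c : ℤ)
    (hv : v ∈ latticePts (Fin d)) (hu : u ∈ latticePts (Fin d)) :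
    u - ((c : ℝ) * dotProd u v) • castZ w ∈ latticePts (Fin d) := by
  obtain ⟨a, rfl⟩ := hv
  obtain ⟨b, rfl⟩ := hu
  refine ⟨fun i => b i - (c * ∑ j, b j * a j) * w i, ?_⟩
  funext i
  simp [castZ, dotProd]

theorem exists_vertex {d : ℕ} (F : Set (Fin d → ℝ)) (hF : IsLatticePolytope F)
    (u : Fin d → ℝ) : ∃ vF ∈ F.extremePoints ℝ,
      sInf ((fun v => dotProd u v) '' F) = dotProd u vF := by
  obtain ⟨S, hS, rfl⟩ := hF
  set F := convexHull ℝ (castZ '' (S : Set (Fin d → ℤ))) with hFdef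
  have hc : IsCompact F := (S.finite_toSet.image _).isCompact_convexHull ℝ
  have hne : F.Nonempty := (convexHull_nonempty_iff).2 ((Finset.coe_nonempty.2 hS).image _)
  have hcont : Continuous (fun v => dotProd u v) := by unfold dotProd; fun_prop
  obtain ⟨x, hx, hmin⟩ := hc.exists_isMinOn hne hcont.continuousOn
  let l : StrongDual ℝ (Fin d → ℝ) :=
    ⟨{ toFun := fun v => - dotProd u v
       map_add' := by
        intro a b
        simp only [dotProd, Pi.add_apply, mul_add, Finset.sum_add_distrib, neg_add]
       map_smul' := by
        intro c a
        simp only [dotProd, Pi.smul_apply, smul_eq_mul, RingHom.id_apply, mul_neg, Finset.mul_sum]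
        congr 1
        exact Finset.sum_congr rfl fun i _ => by ring }, hcont.neg⟩
  have hl : ∀ v, l v = - dotProd u v := fun _ => rfl
  have hexp : IsExposed ℝ F (l.toExposed F) := ContinuousLinearMap.toExposed.isExposed
  have hcK : IsCompact (l.toExposed F) := hexp.isCompact hc
  have hKne : (l.toExposed F).Nonempty :=
    ⟨x, hx, fun y hy => by rw [hl, hl]; exact neg_le_neg (hmin hy)⟩
  obtain ⟨v, hv⟩ := hcK.extremePoints_nonempty hKne
  refine ⟨v, hexp.isExtreme.extremePoints_subset_extremePoints hv, ?_⟩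
  have hvK := hv.1
  refine IsLeast.csInf_eq ⟨⟨v, hvK.1, rfl⟩, ?_⟩
  rintro _ ⟨y, hy, rfl⟩
  have := hvK.2 y hy
  rw [hl, hl] at this
  exact neg_le_neg_iff.1 this

/-- (i) `φ_{w,F}(u) = u − ⟨u,v_F⟩·w` for some vertex `v_F` of `F`;
(ii) each map `u ↦ u − ⟨u,v_F⟩·w` (`v_F` a vertex of `F`) is a linear automorphism
mapping `ℤ^d` bijectively onto `ℤ^d`; (iii) `φ_{w,F}` maps `ℤ^d` bijectively onto `ℤ^d`. -/
theorem stmt_10 {d : ℕ} (w : Fin d → ℤ) (hw : IsPrimitiveVec w)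
    (F : Set (Fin d → ℝ)) (hF : IsLatticePolytope F)
    (hFw : F ⊆ hyperplane (castZ w) 0) :
    (∀ u : Fin d → ℝ, ∃ vF ∈ F.extremePoints ℝ,
        phiMut (castZ w) F u = u - dotProd u vF • castZ w) ∧
    (∀ vF ∈ F.extremePoints ℝ,
        IsLinearMap ℝ (fun u : Fin d → ℝ => u - dotProd u vF • castZ w) ∧
        Function.Bijective (fun u : Fin d → ℝ => u - dotProd u vF • castZ w) ∧
        Set.BijOn (fun u : Fin d → ℝ => u - dotProd u vF • castZ w)
          (latticePts (Fin d)) (latticePts (Fin d))) ∧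
    Set.BijOn (phiMut (castZ w) F) (latticePts (Fin d)) (latticePts (Fin d)) := by
  have hvz : ∀ v ∈ F.extremePoints ℝ, v ∈ latticePts (Fin d) := by
    intro v hv
    obtain ⟨S, hS, rfl⟩ := hF
    obtain ⟨a, _, rfl⟩ := extremePoints_convexHull_subset hv
    exact ⟨a, rfl⟩
  have hw0 : ∀ v ∈ F, dotProd (castZ w) v = 0 := fun v hv => hFw hv
  refine ⟨?_, ?_, ?_⟩
  · intro u
    obtain ⟨v, hv, h⟩ := exists_vertex F hF u
    exact ⟨v, hv, by rw [phiMut, h]⟩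
  · intro v hv
    have h0 := hw0 v hv.1
    have inv1 : ∀ u : Fin d → ℝ, ∀ c : ℝ, dotProd (u - c • castZ w) v = dotProd u v :=
      fun u c => dotProd_sub_smul' _ u v c h0
    have hinj : Function.Injective (fun u : Fin d → ℝ => u - dotProd u v • castZ w) := by
      intro a b hab
      have hab' : a - dotProd a v • castZ w = b - dotProd b v • castZ w := hab
      have h1 : dotProd a v = dotProd b v := by
        rw [← inv1 a (dotProd a v), hab', inv1]
      rw [h1] at hab'
      exact sub_left_injective hab'
    have hsurj : ∀ u : Fin d → ℝ,
        (fun u : Fin d → ℝ => u - dotProd u v • castZ w)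
          (u - (((-1 : ℤ) : ℝ) * dotProd u v) • castZ w) = u := by
      intro u
      simp only [inv1]
      push_cast
      module
    refine ⟨⟨?_, ?_⟩, ⟨hinj, fun u => ⟨_, hsurj u⟩⟩, ?_, hinj.injOn, ?_⟩
    · intro a b
      have : dotProd (a + b) v = dotProd a v + dotProd b v := by
        simp only [dotProd, Pi.add_apply, add_mul, Finset.sum_add_distrib]
      rw [this]
      module
    · intro c a
      have : dotProd (c • a) v = c * dotProd a v := by
        simp only [dotProd, Pi.smul_apply, smul_eq_mul, Finset.mul_sum, mul_assoc]
      rw [this]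
      module
    · intro u hu
      simpa using lattice_sub_smul w u v 1 (hvz v hv) hu
    · intro u hu
      exact ⟨_, lattice_sub_smul w u v (-1) (hvz v hv) hu, hsurj u⟩
  · have inv1 : ∀ u : Fin d → ℝ, ∀ c : ℝ,
        sInf ((fun v => dotProd (u - c • castZ w) v) '' F)
          = sInf ((fun v => dotProd u v) '' F) := by
      intro u c
      congr 1
      exact Set.image_congr fun v hv => dotProd_sub_smul' _ u v c (hw0 v hv)
    refine ⟨?_, ?_, ?_⟩
    · intro u hu
      obtain ⟨v, hv, h⟩ := exists_vertex F hF u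
      rw [phiMut, h]
      simpa using lattice_sub_smul w u v 1 (hvz v hv) hu
    · intro a _ b _ hab
      unfold phiMut at hab
      have h1 : sInf ((fun v => dotProd a v) '' F) = sInf ((fun v => dotProd b v) '' F) := by
        rw [← inv1 a (sInf ((fun v => dotProd a v) '' F)), hab, inv1]
      rw [h1] at hab
      exact sub_left_injective hab
    · intro u hu
      obtain ⟨v, hv, h⟩ := exists_vertex F hF u
      refine ⟨_, lattice_sub_smul w u v (-1) (hvz v hv) hu, ?_⟩
      rw [phiMut, inv1, h]
      push_cast
      module
end

section
/- Let w ∈ ℤ^d be primitive, F ⊆ w^⊥ a lattice polytope, and Q ⊆ ℝ^d a rational polytope. Then for every positive integer m, the number of lattice points #(mQ ∩ ℤ^d) equals #(m·φ_{w,F}(Q) ∩ ℤ^d); that is, Q and φ_{w,F}(Q) have the same Ehrhart quasi-polynomial. -/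
open Set Pointwise

theorem phi_aux_int {d : ℕ} (F : Set (Fin d → ℝ)) (hF : IsLatticePolytope F) (u : Fin d → ℤ) :
    ∃ k : ℤ, sInf ((fun v => dotProd (castZ u) v) '' F) = (k : ℝ) := by
  obtain ⟨S, hS, rfl⟩ := hF
  obtain ⟨s, hs, hmin⟩ := Finset.exists_min_image S (fun s => dotProd (castZ u) (castZ s)) hS
  refine ⟨∑ i, u i * s i, ?_⟩
  have h : IsLeast ((fun v => dotProd (castZ u) v) '' convexHull ℝ (castZ '' (S : Set (Fin d → ℤ))))
      (dotProd (castZ u) (castZ s)) := by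
    refine ⟨⟨castZ s, subset_convexHull _ _ ⟨s, hs, rfl⟩, rfl⟩, ?_⟩
    rintro _ ⟨v, hv, rfl⟩
    have hc : Convex ℝ {v | dotProd (castZ u) (castZ s) ≤ dotProd (castZ u) v} := by
      apply convex_halfSpace_ge
      constructor
      · intro x y
        simp [dotProd, mul_add, Finset.sum_add_distrib]
      · intro c x
        simp [dotProd, Finset.mul_sum, mul_left_comm]
    refine convexHull_min ?_ hc hv
    rintro _ ⟨t, ht, rfl⟩
    exact hmin t ht
  rw [h.csInf_eq]
  simp [dotProd, castZ]

theorem phi_aux_smul {d : ℕ} (F : Set (Fin d → ℝ)) (u : Fin d → ℝ) (m : ℝ) (hm : 0 ≤ m) :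
    sInf ((fun v => dotProd (m • u) v) '' F) = m * sInf ((fun v => dotProd u v) '' F) := by
  rw [← smul_eq_mul, ← Real.sInf_smul_of_nonneg hm, ← Set.image_smul, Set.image_image]
  congr 1
  apply Set.image_congr
  intro v _
  simp [dotProd, Finset.mul_sum, mul_assoc]

theorem phi_aux_add {d : ℕ} (w : Fin d → ℝ) (F : Set (Fin d → ℝ)) (hFw : F ⊆ hyperplane w 0)
    (u : Fin d → ℝ) (c : ℝ) :
    sInf ((fun v => dotProd (u + c • w) v) '' F) = sInf ((fun v => dotProd u v) '' F) := by
  congr 1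
  apply Set.image_congr
  intro v hv
  have h : dotProd w v = 0 := hFw hv
  have h2 : dotProd (u + c • w) v = dotProd u v + c * dotProd w v := by
    simp [dotProd, Finset.mul_sum, mul_assoc, add_mul, Finset.sum_add_distrib]
  rw [h2, h, mul_zero, add_zero]

/-- `Q` and `φ_{w,F}(Q)` have the same Ehrhart quasi-polynomial:
`#(mQ ∩ ℤ^d) = #(m·φ_{w,F}(Q) ∩ ℤ^d)` for every positive integer `m`. -/
theorem stmt_11 {d : ℕ} (w : Fin d → ℤ) (hw : IsPrimitiveVec w)
    (F : Set (Fin d → ℝ)) (hF : IsLatticePolytope F)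
    (hFw : F ⊆ hyperplane (castZ w) 0)
    (Q : Set (Fin d → ℝ)) (hQ : IsRationalPolytope Q) :
    ∀ m : ℕ, 0 < m →
      ((m : ℝ) • Q ∩ latticePts (Fin d)).ncard =
        ((m : ℝ) • (phiMut (castZ w) F '' Q) ∩ latticePts (Fin d)).ncard := by
  intro m hm
  have hleft : ∀ u, phiMut (castZ w) F u +
      sInf ((fun v => dotProd (phiMut (castZ w) F u) v) '' F) • castZ w = u := by
    intro u
    have h : phiMut (castZ w) F u =
        u + (-sInf ((fun v => dotProd u v) '' F)) • castZ w := by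
      rw [phiMut, neg_smul, sub_eq_add_neg]
    rw [h, phi_aux_add _ _ hFw, neg_smul, neg_add_cancel_right]
  have hinj : Function.Injective (phiMut (castZ w) F) := by
    intro a b hab
    rw [← hleft a, ← hleft b, hab]
  have hlat : ∀ u, phiMut (castZ w) F u ∈ latticePts (Fin d) ↔ u ∈ latticePts (Fin d) := by
    intro u
    constructor
    · rintro ⟨z, hz⟩
      obtain ⟨k, hk⟩ := phi_aux_int F hF z
      refine ⟨z + k • w, ?_⟩
      rw [← hleft u, ← hz, hk]
      ext i
      simp [castZ]
    · rintro ⟨z, rfl⟩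
      obtain ⟨k, hk⟩ := phi_aux_int F hF z
      refine ⟨z - k • w, ?_⟩
      rw [phiMut, hk]
      ext i
      simp [castZ]
  have hsm : ∀ u, phiMut (castZ w) F ((m : ℝ) • u) = (m : ℝ) • phiMut (castZ w) F u := by
    intro u
    rw [phiMut, phi_aux_smul _ _ _ (Nat.cast_nonneg m), phiMut, smul_sub, smul_smul]
  have hset : (m : ℝ) • (phiMut (castZ w) F '' Q) ∩ latticePts (Fin d) =
      phiMut (castZ w) F '' ((m : ℝ) • Q ∩ latticePts (Fin d)) := by
    ext x
    constructor
    · rintro ⟨⟨_, ⟨q, hq, rfl⟩, rfl⟩, hx⟩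
      refine ⟨(m : ℝ) • q, ⟨⟨q, hq, rfl⟩, ?_⟩, hsm q⟩
      rw [← hlat, hsm]
      exact hx
    · rintro ⟨_, ⟨⟨q, hq, rfl⟩, hx⟩, rfl⟩
      exact ⟨⟨_, ⟨q, hq, rfl⟩, (hsm q).symm⟩, (hlat _).2 hx⟩
  rw [hset, Set.ncard_image_of_injective _ hinj]
end

section
/- Let P = P' + C ⊆ ℝ^d, where P' is a rational polytope and C = cone({v_1,…,v_m}) is a rational polyhedral pointed cone with primitive minimal generators, and assume the origin is an interior point of P. Let w ∈ ℤ^d be primitive and F ⊆ w^⊥ a lattice polytope. Assume: {G_h}_{h≤0} satisfies the mutation condition for (P',w,F); either m = 0 (so C = {0}) or all ⟨w,v_i⟩ > 0 or all ⟨w,v_i⟩ < 0; and {G_h^C}_{h≤0} is a family of possibly-empty rational polytopes with G_0^C = {0} and {v_1,…,v_m} ∩ H_{w,h} ⊆ G_h^C + (−h)F ⊆ C_{w,h} for all h ≤ 0. Define mut_w(C,F;{G_h^C}) := cone(⋃_{h≤0} G_h^C ∪ ⋃_{h≥0} (C_{w,h} + hF)) and mut_w(P,F) := mut_w(P',F;{G_h})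 + mut_w(C,F;{G_h^C}). Then the image of the polar dual of P under φ_{w,F} equals the polar dual of mut_w(P,F): φ_{w,F}(P*) = (mut_w(P,F))*. -/
open Set Pointwise

theorem dotProd_add_right' {ι : Type*} [Fintype ι] (u x y : ι → ℝ) :
    dotProd u (x + y) = dotProd u x + dotProd u y := by
  simp [dotProd, mul_add, Finset.sum_add_distrib]

theorem dotProd_smul_right' {ι : Type*} [Fintype ι] (u x : ι → ℝ) (c : ℝ) :
    dotProd u (c • x) = c * dotProd u x := by
  simp only [dotProd, Pi.smul_apply, smul_eq_mul, Finset.mul_sum]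
  exact Finset.sum_congr rfl fun i _ => by ring

theorem dotProd_sub_smul_left' {ι : Type*} [Fintype ι] (u w x : ι → ℝ) (c : ℝ) :
    dotProd (u - c • w) x = dotProd u x - c * dotProd w x := by
  simp only [dotProd, Pi.sub_apply, Pi.smul_apply, smul_eq_mul, Finset.mul_sum,
    ← Finset.sum_sub_distrib]
  exact Finset.sum_congr rfl fun i _ => by ring

theorem dotProd_sum_right' {ι κ : Type*} [Fintype ι] [Fintype κ] (u : ι → ℝ) (c : κ → ℝ)
    (x : κ → ι → ℝ) : dotProd u (∑ i, c i • x i) = ∑ i, c i * dotProd u (x i) := by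
  simp only [dotProd, Finset.sum_apply, Pi.smul_apply, smul_eq_mul, Finset.mul_sum]
  rw [Finset.sum_comm]
  exact Finset.sum_congr rfl fun i _ => Finset.sum_congr rfl fun j _ => by ring

theorem dotProd_continuous' {ι : Type*} [Fintype ι] (u : ι → ℝ) :
    Continuous (fun x => dotProd u x) := by
  unfold dotProd
  fun_prop

theorem convex_halfspace' {ι : Type*} [Fintype ι] (u : ι → ℝ) (k : ℝ) :
    Convex ℝ {x | k ≤ dotProd u x} :=
  convex_halfSpace_ge ⟨dotProd_add_right' u, fun c x => dotProd_smul_right' u x c⟩ k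

theorem lattice_compact {ι : Type*} [Fintype ι] {P : Set (ι → ℝ)} (h : IsLatticePolytope P) :
    IsCompact P ∧ P.Nonempty ∧ Convex ℝ P := by
  obtain ⟨S, hS, rfl⟩ := h
  refine ⟨(S.finite_toSet.image castZ).isCompact_convexHull (𝕜 := ℝ), ?_, convex_convexHull ℝ _⟩
  exact (convexHull_nonempty_iff).2 ((Finset.coe_nonempty.2 hS).image _)

theorem rational_compact {ι : Type*} [Fintype ι] {P : Set (ι → ℝ)} (h : IsRationalPolytope P) :
    IsCompact P ∧ P.Nonempty ∧ Convex ℝ P := by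
  obtain ⟨n, hn, hl⟩ := h
  obtain ⟨h1, h2, h3⟩ := lattice_compact hl
  have hn' : (n : ℝ) ≠ 0 := by exact_mod_cast hn.ne'
  have e : P = (n : ℝ)⁻¹ • ((n : ℝ) • P) := (inv_smul_smul₀ hn' P).symm
  rw [e]
  exact ⟨h1.smul _, h2.smul_set, h3.smul _⟩

theorem exists_min {ι : Type*} [Fintype ι] {F : Set (ι → ℝ)} (hF : IsLatticePolytope F)
    (u : ι → ℝ) : ∃ f ∈ F, dotProd u f = sInf ((fun v => dotProd u v) '' F) ∧
      ∀ g ∈ F, dotProd u f ≤ dotProd u g := by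
  obtain ⟨h1, h2, _⟩ := lattice_compact hF
  obtain ⟨f, hf, hmin⟩ := h1.exists_isMinOn h2 (dotProd_continuous' u).continuousOn
  refine ⟨f, hf, ?_, fun g hg => hmin hg⟩
  have hl : IsLeast ((fun v => dotProd u v) '' F) (dotProd u f) := by
    refine ⟨⟨f, hf, rfl⟩, ?_⟩
    rintro _ ⟨g, hg, rfl⟩
    exact hmin hg
  exact hl.csInf_eq.symm

/-- The generators of the mutation. -/
def mutGens {ι : Type*} [Fintype ι] (w : ι → ℝ) (F : Set (ι → ℝ)) (P : Set (ι → ℝ))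
    (G : ℝ → Set (ι → ℝ)) : Set (ι → ℝ) :=
  (⋃ h ∈ Set.Iic (0 : ℝ), G h) ∪ ⋃ h ∈ Set.Ici (0 : ℝ), (P ∩ hyperplane w h + h • F)

theorem gens_forward {ι : Type*} [Fintype ι] {w : ι → ℝ} {F A : Set (ι → ℝ)}
    {G : ℝ → Set (ι → ℝ)} (hF : IsLatticePolytope F) (hFw : F ⊆ hyperplane w 0)
    (hG : ∀ h : ℝ, h ≤ 0 → G h + (-h) • F ⊆ A ∩ hyperplane w h) (k : ℝ) (u : ι → ℝ)
    (hu : ∀ a ∈ A, k ≤ dotProd u a) : ∀ x ∈ mutGens w F A G, k ≤ dotProd (phiMut w F u) x := by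
  obtain ⟨f, hf, hfe, hmin⟩ := exists_min hF u
  intro x hx
  rw [phiMut, ← hfe, dotProd_sub_smul_left']
  rcases hx with hx | hx
  · simp only [mem_iUnion, mem_Iic] at hx
    obtain ⟨h, hh, hx⟩ := hx
    obtain ⟨hA, hH⟩ := hG h hh (add_mem_add hx (smul_mem_smul_set hf))
    have h1 := hu _ hA
    have h2 : dotProd w (x + (-h) • f) = h := hH
    have h3 : dotProd w f = 0 := hFw hf
    rw [dotProd_add_right', dotProd_smul_right'] at h1 h2
    rw [h3] at h2
    have h4 : dotProd w x = h := by linarith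
    rw [h4]
    linarith
  · simp only [mem_iUnion, mem_Ici] at hx
    obtain ⟨h, hh, p, ⟨hp, hpH⟩, _, ⟨g, hg, rfl⟩, rfl⟩ := hx
    have h1 := hu _ hp
    have h2 : dotProd w p = h := hpH
    have h3 : dotProd w g = 0 := hFw hg
    have h4 := mul_le_mul_of_nonneg_left (hmin g hg) hh
    simp only [dotProd_add_right', dotProd_smul_right', h2, h3]
    linarith

theorem gens_backward {ι : Type*} [Fintype ι] {w : ι → ℝ} {F A E : Set (ι → ℝ)}
    {G : ℝ → Set (ι → ℝ)} (hF : IsLatticePolytope F) (hFw : F ⊆ hyperplane w 0) (hE : E ⊆ A)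
    (hG : ∀ h : ℝ, h ≤ 0 → E ∩ hyperplane w h ⊆ G h + (-h) • F ∧
      G h + (-h) • F ⊆ A ∩ hyperplane w h) (k : ℝ) (u : ι → ℝ)
    (hu : ∀ x ∈ mutGens w F A G, k ≤ dotProd (phiMut w F u) x) :
    ∀ e ∈ E, k ≤ dotProd u e := by
  obtain ⟨f, hf, hfe, hmin⟩ := exists_min hF u
  rw [phiMut, ← hfe] at hu
  intro e he
  rcases le_total (dotProd w e) 0 with hh | hh
  · obtain ⟨x, hx, _, ⟨g, hg, rfl⟩, hxe⟩ := (hG _ hh).1 ⟨he, rfl⟩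
    have h1 := hu x (Or.inl (mem_iUnion₂.2 ⟨_, hh, hx⟩))
    have h3 : dotProd w g = 0 := hFw hg
    have h4 := mul_le_mul_of_nonneg_left (hmin g hg) (neg_nonneg.2 hh)
    have h5 := congrArg (dotProd w) hxe
    have h6 := congrArg (dotProd u) hxe
    simp only [dotProd_add_right', dotProd_smul_right', h3] at h5 h6
    rw [dotProd_sub_smul_left'] at h1
    have h7 : dotProd w x = dotProd w e := by linarith
    rw [h7] at h1
    linarith
  · have h1 := hu (e + dotProd w e • f) (Or.inr (mem_iUnion₂.2 ⟨_, hh,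
      add_mem_add ⟨hE he, rfl⟩ (smul_mem_smul_set hf)⟩))
    have h3 : dotProd w f = 0 := hFw hf
    simp only [dotProd_sub_smul_left', dotProd_add_right', dotProd_smul_right', h3] at h1
    linarith

theorem gens_nonempty {ι : Type*} [Fintype ι] {w : ι → ℝ} {F A E : Set (ι → ℝ)}
    {G : ℝ → Set (ι → ℝ)} (hF : IsLatticePolytope F) (hE : E ⊆ A)
    (hG : ∀ h : ℝ, h ≤ 0 → E ∩ hyperplane w h ⊆ G h + (-h) • F) (hne : E.Nonempty) :
    (mutGens w F A G).Nonempty := by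
  obtain ⟨e, he⟩ := hne
  obtain ⟨f, hf⟩ := (lattice_compact hF).2.1
  rcases le_total (dotProd w e) 0 with hh | hh
  · obtain ⟨x, hx, _⟩ := hG _ hh ⟨he, rfl⟩
    exact ⟨x, Or.inl (mem_iUnion₂.2 ⟨_, hh, hx⟩)⟩
  · exact ⟨e + dotProd w e • f, Or.inr (mem_iUnion₂.2 ⟨_, hh,
      add_mem_add ⟨hE he, rfl⟩ (smul_mem_smul_set hf)⟩)⟩

/-- Polar dual of a nonempty set plus a set closed under nonnegative scaling. -/
theorem mem_polarDual_add {ι : Type*} [Fintype ι] {A K : Set (ι → ℝ)} (hA : A.Nonempty)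
    (h0 : (0 : ι → ℝ) ∈ K) (hK : ∀ x ∈ K, ∀ t : ℝ, 0 ≤ t → t • x ∈ K) (u : ι → ℝ) :
    u ∈ polarDual (A + K) ↔ (∀ a ∈ A, -1 ≤ dotProd u a) ∧ ∀ x ∈ K, 0 ≤ dotProd u x := by
  constructor
  · intro h
    refine ⟨fun a ha => by simpa using h _ (add_mem_add ha h0), fun x hx => ?_⟩
    by_contra hneg
    push Not at hneg
    obtain ⟨a, ha⟩ := hA
    have hpos : 0 ≤ (|dotProd u a| + 2) / (-dotProd u x) :=
      div_nonneg (by positivity) (by linarith)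
    have h1 := h _ (add_mem_add ha (hK x hx _ hpos))
    rw [dotProd_add_right', dotProd_smul_right'] at h1
    have h2 : (|dotProd u a| + 2) / (-dotProd u x) * dotProd u x = -(|dotProd u a| + 2) := by
      have : dotProd u x ≠ 0 := hneg.ne
      field_simp
    rw [h2] at h1
    linarith [le_abs_self (dotProd u a)]
  · rintro ⟨h1, h2⟩ _ ⟨a, ha, x, hx, rfl⟩
    rw [dotProd_add_right']
    linarith [h1 a ha, h2 x hx]

theorem nonneg_coneOf {ι κ : Type*} [Fintype ι] [Fintype κ] (v : κ → ι → ℝ) (u : ι → ℝ) :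
    (∀ x ∈ coneOf v, 0 ≤ dotProd u x) ↔ ∀ x ∈ Set.range v, 0 ≤ dotProd u x := by
  classical
  constructor
  · rintro h _ ⟨i, rfl⟩
    refine h _ ⟨Pi.single i 1, fun j => ?_, ?_⟩
    · by_cases hj : j = i
      · subst hj; simp
      · simp [hj]
    · simp [Pi.single_apply]
  · rintro h x ⟨c, hc, rfl⟩
    rw [dotProd_sum_right']
    exact Finset.sum_nonneg fun i _ => mul_nonneg (hc i) (h _ ⟨i, rfl⟩)

theorem range_sub_coneOf {ι κ : Type*} [Fintype ι] [Fintype κ] (v : κ → ι → ℝ) :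
    Set.range v ⊆ coneOf v := by
  classical
  rintro _ ⟨i, rfl⟩
  refine ⟨Pi.single i 1, fun j => ?_, ?_⟩
  · by_cases hj : j = i
    · subst hj; simp
    · simp [hj]
  · simp [Pi.single_apply]

theorem nonneg_coneHull {ι : Type*} [Fintype ι] (S : Set (ι → ℝ)) (u : ι → ℝ) :
    (∀ x ∈ coneHull S, 0 ≤ dotProd u x) ↔ ∀ x ∈ S, 0 ≤ dotProd u x := by
  constructor
  · intro h x hx
    exact h _ ⟨1, fun _ => 1, fun _ => x, fun _ => zero_le_one, fun _ => hx, by simp⟩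
  · rintro h x ⟨n, c, y, hc, hy, rfl⟩
    rw [dotProd_sum_right']
    exact Finset.sum_nonneg fun i _ => mul_nonneg (hc i) (h _ (hy i))

theorem ge_convexHull {ι : Type*} [Fintype ι] (S : Set (ι → ℝ)) (u : ι → ℝ) (k : ℝ) :
    (∀ x ∈ convexHull ℝ S, k ≤ dotProd u x) ↔ ∀ x ∈ S, k ≤ dotProd u x :=
  ⟨fun h x hx => h x (subset_convexHull ℝ S hx),
    fun h x hx => convexHull_min (t := {x | k ≤ dotProd u x}) h (convex_halfspace' u k) hx⟩

theorem ge_extreme {ι : Type*} [Fintype ι] {A : Set (ι → ℝ)} (hA : IsCompact A)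
    (hc : Convex ℝ A) (u : ι → ℝ) (k : ℝ) (h : ∀ x ∈ A.extremePoints ℝ, k ≤ dotProd u x) :
    ∀ x ∈ A, k ≤ dotProd u x := by
  intro x hx
  rw [← closure_convexHull_extremePoints hA hc] at hx
  exact closure_minimal (t := {x | k ≤ dotProd u x})
    (convexHull_min h (convex_halfspace' u k))
    (isClosed_le continuous_const (dotProd_continuous' u)) hx

/-- duality between the combinatorial mutation in `N_ℝ` and the
piecewise-linear map `φ_{w,F}` in `M_ℝ`: `φ_{w,F}(P*) = (mut_w(P,F))*`. -/
theorem stmt_12 {d m : ℕ} (P' : Set (Fin d → ℝ)) (hP' : IsRationalPolytope P')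
    (v : Fin m → Fin d → ℤ)
    (hprim : ∀ i, IsPrimitiveVec (v i))
    (hmin : IsMinimalGen (fun i => castZ (v i)))
    (C : Set (Fin d → ℝ)) (hC : C = coneOf (fun i => castZ (v i)))
    (hpointed : C ∩ (-C) = {0})
    (P : Set (Fin d → ℝ)) (hP : P = P' + C)
    (hint : (0 : Fin d → ℝ) ∈ interior P)
    (w : Fin d → ℤ) (hw : IsPrimitiveVec w)
    (F : Set (Fin d → ℝ)) (hF : IsLatticePolytope F) (hFw : F ⊆ hyperplane (castZ w) 0)
    (G : ℝ → Set (Fin d → ℝ))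
    (hGrat : ∀ h : ℝ, h ≤ 0 → G h = ∅ ∨ IsRationalPolytope (G h))
    (hG : MutCond P' (castZ w) F G)
    (hsign : m = 0 ∨ (∀ i, 0 < dotProd (castZ w) (castZ (v i))) ∨
      (∀ i, dotProd (castZ w) (castZ (v i)) < 0))
    (GC : ℝ → Set (Fin d → ℝ))
    (hGCrat : ∀ h : ℝ, h ≤ 0 → GC h = ∅ ∨ IsRationalPolytope (GC h))
    (hGC0 : GC 0 = {0})
    (hGCcond : ∀ h : ℝ, h ≤ 0 →
      Set.range (fun i => castZ (v i)) ∩ hyperplane (castZ w) h ⊆ GC h + (-h) • F ∧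
      GC h + (-h) • F ⊆ C ∩ hyperplane (castZ w) h) :
    phiMut (castZ w) F '' polarDual P =
      polarDual (mutPoly (castZ w) F P' G + mutCone (castZ w) F C GC) := by
  obtain ⟨hcp, hne, hcv⟩ := rational_compact hP'
  have hext : (P'.extremePoints ℝ).Nonempty := hcp.extremePoints_nonempty hne
  have key : ∀ u, u ∈ polarDual P ↔ phiMut (castZ w) F u ∈
      polarDual (mutPoly (castZ w) F P' G + mutCone (castZ w) F C GC) := by
    intro u
    have hQne : (mutPoly (castZ w) F P' G).Nonempty :=
      convexHull_nonempty_iff.2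
        (gens_nonempty hF extremePoints_subset (fun h hh => (hG h hh).1) hext)
    have hCsub : Set.range (fun i => castZ (v i)) ⊆ C := hC ▸ range_sub_coneOf _
    rw [hP, mem_polarDual_add hne, mem_polarDual_add hQne]
    · have e1 : (∀ a ∈ mutPoly (castZ w) F P' G, -1 ≤ dotProd (phiMut (castZ w) F u) a) ↔
          ∀ a ∈ mutGens (castZ w) F P' G, -1 ≤ dotProd (phiMut (castZ w) F u) a :=
        ge_convexHull _ _ _
      have e2 : (∀ a ∈ mutCone (castZ w) F C GC, 0 ≤ dotProd (phiMut (castZ w) F u) a) ↔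
          ∀ a ∈ mutGens (castZ w) F C GC, 0 ≤ dotProd (phiMut (castZ w) F u) a :=
        nonneg_coneHull _ _
      rw [e1, e2]
      constructor
      · rintro ⟨h1, h2⟩
        exact ⟨gens_forward hF hFw (fun h hh => (hG h hh).2) _ u h1,
          gens_forward hF hFw (fun h hh => (hGCcond h hh).2) _ u h2⟩
      · rintro ⟨h1, h2⟩
        refine ⟨ge_extreme hcp hcv u _
          (gens_backward hF hFw extremePoints_subset hG _ u h1), ?_⟩
        have := gens_backward hF hFw hCsub hGCcond _ u h2
        rw [hC]
        exact (nonneg_coneOf _ u).2 this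
    · exact ⟨0, fun _ => 0, fun _ => 0, fun _ => le_rfl, fun i => i.elim0, by simp⟩
    · rintro _ ⟨n, c, y, hc, hy, rfl⟩ t ht
      exact ⟨n, fun i => t * c i, y, fun i => mul_nonneg ht (hc i), hy, by
        simp [Finset.smul_sum, mul_smul]⟩
    · rw [hC]
      exact ⟨fun _ => 0, fun _ => le_rfl, by simp⟩
    · rw [hC]
      rintro _ ⟨c, hc, rfl⟩ t ht
      exact ⟨fun i => t * c i, fun i => mul_nonneg ht (hc i), by
        simp [Finset.smul_sum, mul_smul]⟩
  have hsurj : ∀ x, ∃ u, phiMut (castZ w) F u = x := by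
    intro x
    refine ⟨x - (-sInf ((fun v => dotProd x v) '' F)) • castZ w, ?_⟩
    have : (fun v => dotProd (x - (-sInf ((fun v => dotProd x v) '' F)) • castZ w) v) '' F
        = (fun v => dotProd x v) '' F := by
      refine Set.image_congr fun f hf => ?_
      have h3 : dotProd (castZ w) f = 0 := hFw hf
      rw [dotProd_sub_smul_left', h3]
      ring
    rw [phiMut, this]
    module
  ext x
  constructor
  · rintro ⟨u, hu, rfl⟩
    exact (key u).1 hu
  · intro hx
    obtain ⟨u, rfl⟩ := hsurj x
    exact ⟨u, (key u).2 hx, rfl⟩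
end

section
/- Let Π be a finite poset and let q ∈ Π be a non-minimal element. In ℝ^Π with standard basis {e_p}_{p∈Π}, set w_q := −e_q and F_q := conv({−e_{q'} : q' is covered by q}). Then F_q ⊆ w_q^⊥, and for every x = (x_p)_{p∈Π} ∈ ℝ^Π one has φ_{w_q,F_q}(x) = x', where x'_q = min{x_q − x_{q'} : q' is covered by q} and x'_p = x_p for all p ≠ q. -/
open Set Pointwise

/-- The width vector `w_q = -e_q` for an element `q` of a finite poset. -/
def posetW {P : Type*} [DecidableEq P] (q : P) : P → ℝ := -(Pi.single q 1)

/-- The factor `F_q = conv{-e_{q'} : q' is covered by q}`. -/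
def posetF (P : Type*) [Fintype P] [DecidableEq P] [PartialOrder P] (q : P) :
    Set (P → ℝ) :=
  convexHull ℝ {y : P → ℝ | ∃ q', q' ⋖ q ∧ y = -(Pi.single q' 1)}

/-- The piecewise-linear map `φ_q := φ_{w_q, F_q}`. -/
noncomputable def posetPhi {P : Type*} [Fintype P] [DecidableEq P] [PartialOrder P]
    (q : P) : (P → ℝ) → (P → ℝ) :=
  phiMut (posetW q) (posetF P q)
/-- `F_q ⊆ w_q^⊥`, and `φ_{w_q,F_q}` replaces the `q`-th coordinate of
`x` by `min{x_q − x_{q'} : q'` is covered by `q}` and keeps all other coordinates. -/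
theorem stmt_14 {P : Type*} [Fintype P] [DecidableEq P] [PartialOrder P]
    (q : P) (hq : ¬ IsMin q) :
    posetF P q ⊆ hyperplane (posetW q) 0 ∧
    ∀ x : P → ℝ,
      posetPhi q x =
        Function.update x q (sInf ((fun q' => x q - x q') '' {q' | q' ⋖ q})) := by
  have hdn : ∀ (x : P → ℝ) (p : P), dotProd x (-(Pi.single p 1)) = - x p := by
    intro x p
    simp [dotProd, Pi.single_apply]
  have hlin : ∀ x : P → ℝ, IsLinearMap ℝ (fun v => dotProd x v) := by
    intro x
    refine ⟨fun a b => ?_, fun c a => ?_⟩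
    · simp [dotProd, mul_add, Finset.sum_add_distrib]
    · simp only [dotProd, Pi.smul_apply, smul_eq_mul, Finset.mul_sum]
      exact Finset.sum_congr rfl fun i _ => by ring
  refine ⟨?_, fun x => ?_⟩
  · refine convexHull_min ?_ (convex_hyperplane (hlin (posetW q)) 0)
    rintro y ⟨p, hp, rfl⟩
    change dotProd (posetW q) _ = 0
    rw [hdn]
    simp [posetW, hp.lt.ne]
  · have hne : {p : P | p ⋖ q}.Nonempty := by
      obtain ⟨a, ha⟩ := not_isMin_iff.1 hq
      haveI : Finite P := inferInstance
      obtain ⟨b, hb, hbq⟩ := (Set.toFinite {p : P | p < q}).exists_le_maximal ha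
      refine ⟨b, hbq.1, fun c hbc hcq => ?_⟩
      exact absurd (hbq.2 hcq hbc.le) hbc.not_ge
    obtain ⟨m, hm, hmax⟩ := Set.exists_max_image {p : P | p ⋖ q} x (Set.toFinite _) hne
    have h1 : IsLeast ((fun v => dotProd x v) '' posetF P q) (- x m) := by
      refine ⟨⟨_, subset_convexHull ℝ _ ⟨m, hm, rfl⟩, hdn x m⟩, ?_⟩
      rintro _ ⟨v, hv, rfl⟩
      have : posetF P q ⊆ {v | - x m ≤ dotProd x v} := by
        refine convexHull_min ?_ (convex_halfSpace_ge (hlin x) _)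
        rintro y ⟨p, hp, rfl⟩
        change _ ≤ dotProd x _
        rw [hdn]
        exact neg_le_neg (hmax p hp)
      exact this hv
    have h2 : IsLeast ((fun q' => x q - x q') '' {q' | q' ⋖ q}) (x q - x m) := by
      refine ⟨⟨m, hm, rfl⟩, ?_⟩
      rintro _ ⟨p, hp, rfl⟩
      exact sub_le_sub_left (hmax p hp) _
    rw [posetPhi, phiMut, h1.csInf_eq, h2.csInf_eq]
    ext p
    by_cases hpq : p = q
    · subst hpq
      simp [posetW]
      try ring
    · simp [posetW, hpq]
end

section
/- Let Π be a finite poset and let q_1,…,q_n be an enumeration of the non-minimal elements of Π such that i < j whenever q_j ≺ q_i (i.e., larger elements come first). For each non-minimal q set w_q := −e_q, F_q := conv({−e_{q'} : q' is covered by q}), and φ_q := φ_{w_q,F_q}. Then the composition φ_{q_n} ∘ ⋯ ∘ φ_{q_1} (applying φ_{q_1} first) equals the transfer map φ : ℝ^Π → ℝ^Π defined by φ(x)_p = x_p if p is minimal in Π, and φ(x)_p = min{x_p − x_{p'} : p' is covered by p} otherwise. -/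
open Set Pointwise

open scoped Classical in
/-- The transfer map of Stanley: `φ(x)_p = x_p` for `p` minimal, and
`φ(x)_p = min{x_p − x_{p'} : p'` covered by `p}` otherwise. -/
noncomputable def transferMap {P : Type*} [Fintype P] [PartialOrder P]
    (x : P → ℝ) : P → ℝ :=
  fun p => if IsMin p then x p else sInf ((fun p' => x p - x p') '' {p' | p' ⋖ p})

theorem posetPhi_apply_aux {P : Type*} [Fintype P] [DecidableEq P] [PartialOrder P]
    (a : P) (ha : ¬ IsMin a) (u : P → ℝ) (p : P) :
    posetPhi a u p = if p = a then transferMap u p else u p := by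
  classical
  by_cases hp : p = a
  swap
  · simp [posetPhi, phiMut, posetW, hp]
  subst hp
  have hne : ∃ c, c ⋖ p := by
    obtain ⟨b, hb⟩ := not_isMin_iff.mp ha
    obtain ⟨c, _, hc⟩ := exists_le_covBy_of_lt hb
    exact ⟨c, hc⟩
  have hfin : ({c | c ⋖ p} : Set P).Finite := Set.toFinite _
  obtain ⟨m, hm, hmax⟩ := hfin.exists_maximalFor u _ hne
  have hmax : ∀ c, c ⋖ p → u c ≤ u m := fun c hc => by
    rcases le_total (u c) (u m) with h | h
    · exact h
    · exact hmax hc h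
  have hd : ∀ c, dotProd u (-(Pi.single c 1)) = - u c := by
    intro c
    simp [dotProd, Pi.single_apply]
  have h1 : IsLeast ((fun v => dotProd u v) '' posetF P p) (- u m) := by
    refine ⟨⟨_, subset_convexHull ℝ _ ⟨m, hm, rfl⟩, hd m⟩, ?_⟩
    rintro _ ⟨v, hv, rfl⟩
    have hconv : Convex ℝ {v : P → ℝ | - u m ≤ dotProd u v} := by
      refine convex_halfSpace_ge ⟨?_, ?_⟩ _
      · intro x y
        simp [dotProd, mul_add, Finset.sum_add_distrib]
      · intro c x
        simp only [dotProd, Pi.smul_apply, smul_eq_mul, Finset.mul_sum]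
        exact Finset.sum_congr rfl fun i _ => by ring
    refine convexHull_min ?_ hconv hv
    rintro _ ⟨c, hc, rfl⟩
    show - u m ≤ _
    rw [hd]
    linarith [hmax c hc]
  have h2 : IsLeast ((fun p' => u p - u p') '' {p' | p' ⋖ p}) (u p - u m) := by
    refine ⟨⟨m, hm, rfl⟩, ?_⟩
    rintro _ ⟨c, hc, rfl⟩
    have := hmax c hc
    show u p - u m ≤ u p - u c
    linarith
  simp only [posetPhi, phiMut, posetW, transferMap, if_neg ha, h1.csInf_eq, h2.csInf_eq]
  simp

theorem foldl_aux {P : Type*} [Fintype P] [DecidableEq P] [PartialOrder P]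
    (l : List P) (hnd : l.Nodup) (hmin : ∀ a ∈ l, ¬ IsMin a)
    (hpw : l.Pairwise (fun a b => ¬ a < b)) (x : P → ℝ) (p : P) :
    l.foldl (fun y p => posetPhi p y) x p = if p ∈ l then transferMap x p else x p := by
  induction l generalizing x with
  | nil => simp
  | cons a t ih =>
    rw [List.nodup_cons] at hnd
    rw [List.pairwise_cons] at hpw
    have hy := posetPhi_apply_aux a (hmin a (by simp)) x
    rw [List.foldl_cons, ih hnd.2 (fun b hb => hmin b (by simp [hb])) hpw.2]
    by_cases hpt : p ∈ t
    · have hpa : p ≠ a := fun h => hnd.1 (h ▸ hpt)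
      simp only [hpt, if_true, List.mem_cons, or_true]
      simp only [transferMap, hy p, if_neg hpa]
      congr 2
      apply Set.image_congr
      intro c hc
      have hca : c ≠ a := by
        rintro rfl
        exact hpw.1 p hpt hc.lt
      simp only [hy c, if_neg hca]
    · simp [hpt, hy p]

/-- For an enumeration `q_1,…,q_n` of the non-minimal elements of `Π`
from top to bottom, the composition `φ_{q_n} ∘ ⋯ ∘ φ_{q_1}` equals the transfer map. -/
theorem stmt_15 {P : Type*} [Fintype P] [DecidableEq P] [PartialOrder P]
    {n : ℕ} (q : Fin n → P) (hinj : Function.Injective q)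
    (hrange : Set.range q = {p : P | ¬ IsMin p})
    (horder : ∀ i j, q j < q i → i < j) :
    (fun x : P → ℝ => (List.ofFn q).foldl (fun y p => posetPhi p y) x) = transferMap := by
  funext x p
  rw [foldl_aux]
  · have hmem : p ∈ List.ofFn q ↔ ¬ IsMin p := by
      rw [List.mem_ofFn, ← Set.mem_range, hrange]
      rfl
    by_cases hp : IsMin p
    · simp [hmem, hp, transferMap]
    · simp [hmem, hp]
  · exact List.nodup_ofFn.mpr hinj
  · intro a ha
    rw [List.mem_ofFn, ← Set.mem_range, hrange] at ha
    exact ha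
  · rw [List.pairwise_ofFn]
    intro i j hij h
    exact absurd (horder j i h) (not_lt.mpr hij.le)
end

section
/- Let Π be a finite poset and let q_1,…,q_n be an enumeration of the non-minimal elements of Π such that i < j whenever q_j ≺ q_i. For each non-minimal q set w_q := −e_q, F_q := conv({−e_{q'} : q' is covered by q}), and φ_q := φ_{w_q,F_q}. Then the composition φ_{q_n} ∘ ⋯ ∘ φ_{q_1} (applying φ_{q_1} first) maps the order polytope O(Π) bijectively onto the chain polytope C(Π): in particular (φ_{q_n} ∘ ⋯ ∘ φ_{q_1})(O(Π)) = C(Π). Hence the chain polytope of Π is obtained from the order polytope of Π by a sequence of combinatorial mutations (the maps φ_{w,F}). -/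
open Set Pointwise

/-- The order polytope of a finite poset. -/
def orderPolytope (P : Type*) [Fintype P] [PartialOrder P] : Set (P → ℝ) :=
  {x | (∀ p, 0 ≤ x p ∧ x p ≤ 1) ∧ ∀ p q : P, p ≤ q → x p ≤ x q}

/-- The chain polytope of a finite poset. -/
def chainPolytope (P : Type*) [Fintype P] [PartialOrder P] : Set (P → ℝ) :=
  {x | (∀ p, 0 ≤ x p) ∧ ∀ l : List P, l.Chain' (· < ·) → (l.map x).sum ≤ 1}

section helpers

set_option linter.unusedSectionVars false

variable {P : Type*} [Fintype P] [DecidableEq P] [PartialOrder P]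

/-- The maximum of `x` over the elements covered by `p` (`0` if there are none). -/
noncomputable def covMax (x : P → ℝ) (p : P) : ℝ := sSup (x '' {r | r ⋖ p})

theorem covMax_congr {x y : P → ℝ} {p : P} (h : ∀ r, r ⋖ p → x r = y r) :
    covMax x p = covMax y p := by
  unfold covMax
  exact congrArg sSup (Set.image_congr (s := {r | r ⋖ p}) (fun r hr => h r hr))

theorem le_covMax (x : P → ℝ) {p r : P} (h : r ⋖ p) : x r ≤ covMax x p :=
  le_csSup (Set.toFinite _).bddAbove ⟨r, h, rfl⟩

theorem covMax_attained (x : P → ℝ) {p r : P} (h : r ⋖ p) :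
    ∃ s, s ⋖ p ∧ covMax x p = x s := by
  obtain ⟨s, hs, e⟩ := (Set.Nonempty.image x (⟨r, h⟩ : {r | r ⋖ p}.Nonempty)).csSup_mem
    (Set.toFinite _)
  exact ⟨s, hs, e.symm⟩

theorem covMax_zero (x : P → ℝ) {p : P} (h : ∀ r, ¬ r ⋖ p) : covMax x p = 0 := by
  have : {r | r ⋖ p} = ∅ := Set.eq_empty_of_forall_notMem h
  simp [covMax, this]

theorem exists_cov {a b : P} (h : a < b) : ∃ r, a ≤ r ∧ r ⋖ b :=
  exists_le_covBy_of_lt h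

theorem dotProd_neg_single (u : P → ℝ) (r : P) :
    dotProd u (-(Pi.single r 1)) = - u r := by
  simp [dotProd, Pi.single_apply]

theorem sInf_posetF (u : P → ℝ) (p : P) :
    sInf ((fun v => dotProd u v) '' posetF P p) = - covMax u p := by
  by_cases h : ∃ r, r ⋖ p
  · obtain ⟨r, hr⟩ := h
    obtain ⟨s, hs, e⟩ := covMax_attained u hr
    apply IsLeast.csInf_eq
    constructor
    · refine ⟨-(Pi.single s 1), subset_convexHull ℝ _ ⟨s, hs, rfl⟩, ?_⟩
      show dotProd u _ = _
      rw [dotProd_neg_single, e]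
    · rintro _ ⟨v, hv, rfl⟩
      have hc : Convex ℝ {v : P → ℝ | -covMax u p ≤ dotProd u v} := by
        apply convex_halfSpace_ge
        constructor
        · intro a b; simp [dotProd, mul_add, Finset.sum_add_distrib]
        · intro c a; simp only [dotProd, Pi.smul_apply, smul_eq_mul, Finset.mul_sum]
          exact Finset.sum_congr rfl fun i _ => by ring
      refine convexHull_min ?_ hc hv
      rintro _ ⟨t, ht, rfl⟩
      show _ ≤ dotProd u _
      rw [dotProd_neg_single]
      exact neg_le_neg (le_covMax u ht)
  · push Not at h
    rw [covMax_zero u h]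
    have : {y : P → ℝ | ∃ q', q' ⋖ p ∧ y = -(Pi.single q' 1)} = ∅ := by
      apply Set.eq_empty_of_forall_notMem
      rintro _ ⟨t, ht, -⟩
      exact h t ht
    simp [posetF, this]

theorem posetPhi_apply (u : P → ℝ) (p r : P) :
    posetPhi p u r = if r = p then u r - covMax u r else u r := by
  unfold posetPhi phiMut
  rw [sInf_posetF]
  by_cases h : r = p
  · subst h; simp [posetW]
  · simp [posetW, h]

theorem foldl_apply (l : List P) (hl : l.Pairwise (fun a b => a ≠ b ∧ ¬ a < b)) (x : P → ℝ) (r : P) :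
    l.foldl (fun y p => posetPhi p y) x r = if r ∈ l then x r - covMax x r else x r := by
  induction l generalizing x with
  | nil => simp
  | cons a l ih =>
    rw [List.pairwise_cons] at hl
    rw [List.foldl_cons, ih hl.2]
    by_cases h : r ∈ l
    · have h1 := hl.1 r h
      have h2 : covMax (posetPhi a x) r = covMax x r := by
        apply covMax_congr
        intro s hs
        rw [posetPhi_apply, if_neg]
        rintro rfl
        exact h1.2 hs.lt
      rw [if_pos h, if_pos (List.mem_cons_of_mem _ h), h2, posetPhi_apply, if_neg (Ne.symm h1.1)]
    · rw [if_neg h, posetPhi_apply]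
      simp [h]

theorem foldl_eq {n : ℕ} (q : Fin n → P) (hinj : Function.Injective q)
    (hrange : Set.range q = {p : P | ¬ IsMin p})
    (horder : ∀ i j, q j < q i → i < j) (x : P → ℝ) :
    (List.ofFn q).foldl (fun y p => posetPhi p y) x = fun p => x p - covMax x p := by
  funext r
  rw [foldl_apply]
  · split_ifs with h
    · rfl
    · rw [covMax_zero, sub_zero]
      intro s hs
      apply h
      rw [List.mem_ofFn', hrange]
      exact fun hm => hm.not_lt hs.lt
  · rw [List.pairwise_ofFn]
    intro i j hij
    exact ⟨fun e => hij.ne (hinj e), fun hlt => absurd (horder j i hlt) (not_lt.2 hij.le)⟩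

theorem chain_bound {x : P → ℝ} (hx : x ∈ orderPolytope P) (l : List P) (a : P)
    (hl : (a :: l).IsChain (· < ·)) :
    x a + (l.map (fun p => x p - covMax x p)).sum ≤ 1 := by
  induction l generalizing a with
  | nil => simpa using (hx.1 a).2
  | cons b l ih =>
    rw [List.isChain_cons_cons] at hl
    have h1 := ih b hl.2
    obtain ⟨r, har, hr⟩ := exists_cov hl.1
    have h2 := hx.2 _ _ har
    have h3 := le_covMax x hr
    simp only [List.map_cons, List.sum_cons]
    linarith

theorem covMax_nonneg {x : P → ℝ} {p : P} (hx : ∀ r, r ⋖ p → 0 ≤ x r) : 0 ≤ covMax x p := by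
  apply Real.sSup_nonneg
  rintro _ ⟨r, hr, rfl⟩
  exact hx r hr

theorem transfer_mapsTo {x : P → ℝ} (hx : x ∈ orderPolytope P) :
    (fun p => x p - covMax x p) ∈ chainPolytope P := by
  constructor
  · intro p
    show 0 ≤ x p - covMax x p
    by_cases h : ∃ r, r ⋖ p
    · obtain ⟨r, hr⟩ := h
      obtain ⟨s, hs, e⟩ := covMax_attained x hr
      have := hx.2 _ _ hs.le
      linarith
    · push Not at h
      rw [covMax_zero x h, sub_zero]
      exact (hx.1 p).1
  · intro l hl
    have hl : l.IsChain (· < ·) := hl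
    cases l with
    | nil => simp
    | cons a l =>
      have h1 := chain_bound hx l a hl
      have h2 : 0 ≤ covMax x a := covMax_nonneg fun r _ => (hx.1 r).1
      simp only [List.map_cons, List.sum_cons]
      linarith

theorem transfer_inj {x y : P → ℝ}
    (h : (fun p => x p - covMax x p) = fun p => y p - covMax y p) : x = y := by
  funext p
  induction p using (wellFounded_lt (α := P)).induction with
  | _ p ih =>
    have h1 := congrFun h p
    have h2 : covMax x p = covMax y p := covMax_congr fun r hr => ih r hr.lt
    simp only [h2] at h1
    linarith

theorem exists_inv (y : P → ℝ) : ∃ x : P → ℝ, ∀ p, x p = y p + covMax x p := by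
  classical
  let F : (p : P) → ((r : P) → r < p → ℝ) → ℝ := fun p f =>
    y p + covMax (fun r => if h : r < p then f r h else 0) p
  refine ⟨(wellFounded_lt (α := P)).fix F, fun p => ?_⟩
  rw [WellFounded.fix_eq]
  show y p + _ = _
  congr 1
  apply covMax_congr
  intro r hr
  rw [dif_pos hr.lt]

theorem inv_chain {x y : P → ℝ} (h : ∀ p, x p = y p + covMax x p) (p : P) :
    ∃ l : List P, (l ++ [p]).IsChain (· < ·) ∧ x p = ((l ++ [p]).map y).sum := by
  induction p using (wellFounded_lt (α := P)).induction with
  | _ p ih =>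
    by_cases hc : ∃ r, r ⋖ p
    · obtain ⟨r, hr⟩ := hc
      obtain ⟨s, hs, e⟩ := covMax_attained x hr
      obtain ⟨l, hl, hsum⟩ := ih s hs.lt
      refine ⟨l ++ [s], ?_, ?_⟩
      · rw [List.append_assoc]
        show List.IsChain _ (l ++ s :: p :: [])
        rw [List.isChain_append_cons_cons]
        exact ⟨hl, hs.lt, List.isChain_singleton _⟩
      · rw [List.map_append, List.sum_append, ← hsum, h p, e]
        simp [add_comm]
    · push Not at hc
      refine ⟨[], List.isChain_singleton _, ?_⟩
      rw [h p, covMax_zero x hc]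
      simp

theorem transfer_surj {y : P → ℝ} (hy : y ∈ chainPolytope P) :
    ∃ x ∈ orderPolytope P, (fun p => x p - covMax x p) = y := by
  obtain ⟨x, hx⟩ := exists_inv y
  have hnn : ∀ p, 0 ≤ x p := by
    intro p
    induction p using (wellFounded_lt (α := P)).induction with
    | _ p ih =>
      rw [hx p]
      exact add_nonneg (hy.1 p) (covMax_nonneg fun r hr => ih r hr.lt)
  refine ⟨x, ⟨fun p => ⟨hnn p, ?_⟩, ?_⟩, ?_⟩
  · obtain ⟨l, hl, e⟩ := inv_chain hx p
    rw [e]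
    exact hy.2 _ hl
  · intro p q
    induction q using (wellFounded_lt (α := P)).induction with
    | _ q ih =>
      intro hpq
      rcases hpq.eq_or_lt with rfl | hlt
      · exact le_rfl
      · obtain ⟨r, hpr, hr⟩ := exists_cov hlt
        have h1 := ih r hr.lt hpr
        have h2 := le_covMax x hr
        have h3 := hy.1 q
        rw [hx q]
        linarith
  · funext p
    have := hx p
    linarith

end helpers

/-- The composition `φ_{q_n} ∘ ⋯ ∘ φ_{q_1}` maps the order polytope
`O(Π)` bijectively onto the chain polytope `C(Π)`. -/
theorem stmt_16 {P : Type*} [Fintype P] [DecidableEq P] [PartialOrder P]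
    {n : ℕ} (q : Fin n → P) (hinj : Function.Injective q)
    (hrange : Set.range q = {p : P | ¬ IsMin p})
    (horder : ∀ i j, q j < q i → i < j) :
    Set.BijOn (fun x : P → ℝ => (List.ofFn q).foldl (fun y p => posetPhi p y) x)
        (orderPolytope P) (chainPolytope P) ∧
      (fun x : P → ℝ => (List.ofFn q).foldl (fun y p => posetPhi p y) x) ''
        orderPolytope P = chainPolytope P := by
  have hb : Set.BijOn (fun x : P → ℝ => (List.ofFn q).foldl (fun y p => posetPhi p y) x)
      (orderPolytope P) (chainPolytope P) := by
    have he : (fun x : P → ℝ => (List.ofFn q).foldl (fun y p => posetPhi p y) x) =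
        fun x p => x p - covMax x p := funext fun x => foldl_eq q hinj hrange horder x
    rw [he]
    refine ⟨fun x hx => transfer_mapsTo hx, fun x _ y _ h => transfer_inj h, fun y hy => ?_⟩
    obtain ⟨x, hx, e⟩ := transfer_surj hy
    exact ⟨x, hx, e⟩
  exact ⟨hb, hb.image_eq⟩
end
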